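/- arXiv:2405.07415 — 3 statements merged into one kernel-verified Lean document; each statement's English description precedes it below -/
import Mathlib

section
/- Interval-dominance argmin monotonicity: Let Q : {0,…,M} × {1,…,L} → ℝ. Suppose that for every pair of queue states b < b' and every pair of actions u < u'' there exists a constant γ = γ(b,b',u,u'') > 0 such that Q(b',u'') − Q(b',u) ≤ γ·(Q(b,u'') − Q(b,u)). Then the map b ↦ min argmin_{u ∈ {1,…,L}} Q(b,u), sending b to the smallest minimizer of Q(b,·), is nondecreasing. -/
/-- The set of minimizers over a nonempty finite set is nonempty. -/
lemma argmin_nonempty (s : Finset ℕ) (hs : s.Nonempty) (Q : ℕ → ℝ) :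
    (s.filter fun u => ∀ u' ∈ s, Q u ≤ Q u').Nonempty := by
  obtain ⟨u, hu, hmin⟩ := s.exists_min_image Q hs
  exact ⟨u, Finset.mem_filter.2 ⟨hu, hmin⟩⟩

/-- The smallest minimizer of `Q` over the finite set `s`. -/
noncomputable def argminMin (s : Finset ℕ) (hs : s.Nonempty) (Q : ℕ → ℝ) : ℕ :=
  (s.filter fun u => ∀ u' ∈ s, Q u ≤ Q u').min' (argmin_nonempty s hs Q)

lemma argminMin_spec (s : Finset ℕ) (hs : s.Nonempty) (Q : ℕ → ℝ) :
    argminMin s hs Q ∈ s ∧ ∀ u ∈ s, Q (argminMin s hs Q) ≤ Q u :=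
  Finset.mem_filter.1 (Finset.min'_mem _ (argmin_nonempty s hs Q))

lemma lt_of_lt_argminMin {s : Finset ℕ} {hs : s.Nonempty} {Q : ℕ → ℝ} {u : ℕ}
    (hu : u ∈ s) (hlt : u < argminMin s hs Q) : Q (argminMin s hs Q) < Q u := by
  by_contra! hle
  have hmem : u ∈ s.filter fun v => ∀ u' ∈ s, Q v ≤ Q u' :=
    Finset.mem_filter.2 ⟨hu, fun v hv => hle.trans ((argminMin_spec s hs Q).2 v hv)⟩
  exact hlt.not_ge (Finset.min'_le _ u hmem)

/-- **Interval-dominance argmin monotonicity.**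
Let `Q : {0,…,M} × {1,…,L} → ℝ`. Suppose that for every pair of queue states `b < b'` and
every pair of actions `u < u''` there exists a constant `γ = γ(b,b',u,u'') > 0` such that
`Q b' u'' - Q b' u ≤ γ (Q b u'' - Q b u)`. Then the map sending `b` to the smallest
minimizer of `Q b ·` over `{1,…,L}` is nondecreasing. -/
theorem interval_dominance_argmin_monotone (M L : ℕ) (hL : 1 ≤ L)
    (Q : ℕ → ℕ → ℝ)
    (hID : ∀ b b' u u'', b < b' → b' ≤ M → 1 ≤ u → u < u'' → u'' ≤ L →
      ∃ γ : ℝ, 0 < γ ∧ Q b' u'' - Q b' u ≤ γ * (Q b u'' - Q b u)) :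
    ∀ b b', b ≤ b' → b' ≤ M →
      argminMin (Finset.Icc 1 L) ⟨1, Finset.mem_Icc.mpr ⟨le_refl 1, hL⟩⟩ (Q b) ≤
      argminMin (Finset.Icc 1 L) ⟨1, Finset.mem_Icc.mpr ⟨le_refl 1, hL⟩⟩ (Q b') := by
  intro b b' hbb' hb'
  rcases hbb'.eq_or_lt with rfl | hlt
  · exact le_rfl
  by_contra! h
  have hs : (Finset.Icc 1 L).Nonempty := ⟨1, Finset.mem_Icc.mpr ⟨le_refl 1, hL⟩⟩
  obtain ⟨hmem, -⟩ := argminMin_spec (Finset.Icc 1 L) hs (Q b)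
  obtain ⟨hmem', hmin'⟩ := argminMin_spec (Finset.Icc 1 L) hs (Q b')
  obtain ⟨γ, hγ, hQ⟩ := hID b b' _ _ hlt hb' (Finset.mem_Icc.1 hmem').1 h
    (Finset.mem_Icc.1 hmem).2
  have hneg := mul_neg_of_pos_of_neg hγ (sub_neg.2 (lt_of_lt_argminMin hmem' h))
  linarith [hmin' _ hmem]
end

section
/- Monotonicity of the value function in the queue state: Assume (R1) for every n, o, u the map b ↦ c_n((o,b),u) is nondecreasing, (R3) for every o the map b ↦ d((o,b)) is nondecreasing, and each queue transition matrix P^{o,u} is row-stochastic and TP2. Then the value functions defined by the Bellman recursion satisfy: for every n and every oracle state o, the map b ↦ V_n((o,b)) is nondecreasing. -/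
/-- `v` is nondecreasing on `{0,…,M}`. -/
def MonoUpTo (M : ℕ) (v : ℕ → ℝ) : Prop :=
  ∀ b b', b ≤ b' → b' ≤ M → v b ≤ v b'

/-- Bellman value function of the finite-horizon MDP with oracle states `{0,…,R-1}`,
queue states `{0,…,M}`, actions `{1,…,L}`, oracle transition matrix `PO`, queue transition
matrices `Pq o u`, per-stage costs `c` and terminal cost `dcost`:
`V 0 (o,b) = dcost o b` and
`V (n+1) (o,b) = min_{u ∈ {1,…,L}} [c (n+1) (o,b) u + Σ_{o',b'} PO o o' * Pq o u b b' * V n (o',b')]`. -/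
noncomputable def Vval (R M L : ℕ) (PO : ℕ → ℕ → ℝ) (Pq : ℕ → ℕ → ℕ → ℕ → ℝ)
    (c : ℕ → ℕ → ℕ → ℕ → ℝ) (dcost : ℕ → ℕ → ℝ) : ℕ → ℕ → ℕ → ℝ
  | 0, o, b => dcost o b
  | n + 1, o, b =>
    sInf ((fun u => c (n + 1) o b u +
      ∑ o' ∈ Finset.range R, ∑ b' ∈ Finset.range (M + 1),
        PO o o' * Pq o u b b' * Vval R M L PO Pq c dcost n o' b') '' Set.Icc 1 L)

/-- Expectations of a monotone function are ordered by the likelihood ratio order. -/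
theorem sum_mul_le_sum_mul_of_likelihood_ratio {ι : Type*} [LinearOrder ι] (s : Finset ι)
    (p q v : ι → ℝ) (hp : ∑ i ∈ s, p i = 1) (hq : ∑ i ∈ s, q i = 1)
    (hpq : ∀ i ∈ s, ∀ j ∈ s, i < j → p j * q i ≤ p i * q j) (hv : MonotoneOn v s) :
    ∑ i ∈ s, p i * v i ≤ ∑ i ∈ s, q i * v i := by
  have hnonneg : 0 ≤ ∑ i ∈ s, ∑ j ∈ s, (p i * q j - p j * q i) * (v j - v i) := by
    refine Finset.sum_nonneg fun i hi => Finset.sum_nonneg fun j hj => ?_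
    rcases lt_trichotomy i j with hij | rfl | hij
    · exact mul_nonneg (sub_nonneg.2 (hpq i hi j hj hij)) (sub_nonneg.2 (hv hi hj hij.le))
    · simp
    · exact mul_nonneg_of_nonpos_of_nonpos
        (by linarith [hpq j hj i hi hij]) (sub_nonpos.2 (hv hj hi hij.le))
  have hexpand : ∑ i ∈ s, ∑ j ∈ s, (p i * q j - p j * q i) * (v j - v i) =
      2 * ((∑ i ∈ s, p i) * ∑ i ∈ s, q i * v i) -
        2 * ((∑ i ∈ s, q i) * ∑ i ∈ s, p i * v i) := by
    calc
      _ = ∑ i ∈ s, ∑ j ∈ s, (p i * (q j * v j) - (p i * v i) * q j -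
            q i * (p j * v j) + (q i * v i) * p j) :=
        Finset.sum_congr rfl fun i _ => Finset.sum_congr rfl fun j _ => by ring
      _ = _ := by
        simp only [Finset.sum_add_distrib, Finset.sum_sub_distrib, ← Finset.sum_mul_sum]
        ring
  rw [hexpand, hp, hq] at hnonneg
  linarith

/-- **Monotonicity of the value function in the queue state.**
Assume (R1): for every `n`, `o`, `u` the map `b ↦ c n (o,b) u` is nondecreasing; (R3): for
every `o` the map `b ↦ d (o,b)` is nondecreasing; and each queue transition matrix
`Pq o u` is row-stochastic and TP2. Then for every `n` and every oracle state `o`, the map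
`b ↦ V n (o,b)` is nondecreasing. -/
theorem value_function_monotone_in_queue (R M L : ℕ) (hR : 0 < R) (hL : 1 ≤ L)
    (PO : ℕ → ℕ → ℝ) (Pq : ℕ → ℕ → ℕ → ℕ → ℝ)
    (c : ℕ → ℕ → ℕ → ℕ → ℝ) (dcost : ℕ → ℕ → ℝ)
    -- transition probabilities
    (hPO_nonneg : ∀ o o', 0 ≤ PO o o')
    (hPO_sum : ∀ o, o < R → ∑ o' ∈ Finset.range R, PO o o' = 1)
    (hPq_nonneg : ∀ o u b b', 0 ≤ Pq o u b b')
    (hPq_sum : ∀ o u b, o < R → u ∈ Finset.Icc 1 L → b ≤ M →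
      ∑ b' ∈ Finset.range (M + 1), Pq o u b b' = 1)
    -- each queue transition matrix is TP2
    (hPq_tp2 : ∀ o u, o < R → u ∈ Finset.Icc 1 L →
      ∀ i1 i2 j1 j2, i1 < i2 → i2 ≤ M → j1 < j2 → j2 ≤ M →
        0 ≤ Pq o u i1 j1 * Pq o u i2 j2 - Pq o u i1 j2 * Pq o u i2 j1)
    -- (R1): per-stage cost nondecreasing in the queue state
    (hR1_mono : ∀ n o u, o < R → u ∈ Finset.Icc 1 L → MonoUpTo M (fun b => c n o b u))
    -- (R3): terminal cost nondecreasing in the queue state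
    (hR3_mono : ∀ o, o < R → MonoUpTo M (fun b => dcost o b)) :
    ∀ n o, o < R → MonoUpTo M (fun b => Vval R M L PO Pq c dcost n o b) := by
  intro n
  induction n with
  | zero => exact hR3_mono
  | succ n ih =>
    intro o ho b b' hbb' hb'
    rcases hbb'.eq_or_lt with rfl | hlt
    · exact le_rfl
    simp only [Vval]
    refine le_csInf ((Set.nonempty_Icc.2 hL).image _) ?_
    rintro _ ⟨u, hu, rfl⟩
    refine (csInf_le ((Set.finite_Icc 1 L).image _).bddBelow ⟨u, hu, rfl⟩).trans ?_
    have hu' : u ∈ Finset.Icc 1 L := Finset.mem_Icc.2 hu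
    refine add_le_add (hR1_mono (n + 1) o u ho hu' b b' hbb' hb')
      (Finset.sum_le_sum fun o' ho' => ?_)
    simp only [mul_assoc, ← Finset.mul_sum]
    refine mul_le_mul_of_nonneg_left ?_ (hPO_nonneg o o')
    refine sum_mul_le_sum_mul_of_likelihood_ratio _ _ _ _
      (hPq_sum o u b ho hu' (hbb'.trans hb')) (hPq_sum o u b' ho hu' hb') ?_ ?_
    · intro i _ j hj hij
      exact sub_nonneg.1 (hPq_tp2 o u ho hu' b b' i j hlt hb' hij
        (Finset.mem_range_succ_iff.1 hj))
    · intro i _ j hj hij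
      exact ih o' (Finset.mem_range.1 ho') i j hij
        (Finset.mem_range_succ_iff.1 (Finset.mem_coe.1 hj))
end

section
/- The bidiagonal queue kernel preserves increasing discrete convexity: Let 0 ≤ p ≤ 1 and let v : {0,…,M} → ℝ be nondecreasing and discretely convex. Define (Pv)(0) = v(0) and (Pv)(b) = p·v(b−1) + (1−p)·v(b) for 1 ≤ b ≤ M. Then Pv is nondecreasing and discretely convex on {0,…,M}. -/
/-- `v` is discretely convex on `{0,…,M}`: `v (b+1) - v b ≥ v b - v (b-1)` for `0 < b < M`. -/
def ConvUpTo (M : ℕ) (v : ℕ → ℝ) : Prop :=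
  ∀ b, 0 < b → b < M → v b - v (b - 1) ≤ v (b + 1) - v b

/-- **The bidiagonal queue kernel preserves increasing discrete convexity.**
Let `0 ≤ p ≤ 1` and let `v : {0,…,M} → ℝ` be nondecreasing and discretely convex. Define
`(Pv) 0 = v 0` and `(Pv) b = p * v (b-1) + (1-p) * v b` for `1 ≤ b ≤ M`. Then `Pv` is
nondecreasing and discretely convex on `{0,…,M}`. -/
theorem bidiagonal_kernel_preserves_convexity (M : ℕ) (p : ℝ) (hp0 : 0 ≤ p) (hp1 : p ≤ 1)
    (v : ℕ → ℝ) (hv_mono : MonoUpTo M v) (hv_conv : ConvUpTo M v)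
    (Pv : ℕ → ℝ)
    (hPv0 : Pv 0 = v 0)
    (hPv : ∀ b, 1 ≤ b → b ≤ M → Pv b = p * v (b - 1) + (1 - p) * v b) :
    MonoUpTo M Pv ∧ ConvUpTo M Pv := by
  have hP : ∀ b ≤ M, Pv b = p * v (b - 1) + (1 - p) * v b := by
    rintro (_ | b) hb
    · rw [hPv0, Nat.zero_sub]
      ring
    · exact hPv (b + 1) (by omega) hb
  have hq : 0 ≤ 1 - p := sub_nonneg.mpr hp1
  refine ⟨fun b b' hbb' hb' ↦ ?_, fun b hb hbM ↦ ?_⟩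
  · rw [hP b (hbb'.trans hb'), hP b' hb']
    exact add_le_add
      (mul_le_mul_of_nonneg_left (hv_mono _ _ (by omega) (by omega)) hp0)
      (mul_le_mul_of_nonneg_left (hv_mono _ _ hbb' hb') hq)
  · have hprev : v (b - 1) - v (b - 1 - 1) ≤ v b - v (b - 1) := by
      obtain rfl | hb1 : b = 1 ∨ 1 < b := by omega
      · simpa using hv_mono 0 1 zero_le_one hbM.le
      · simpa [Nat.sub_add_cancel hb] using hv_conv (b - 1) (by omega) (by omega)
    rw [hP b hbM.le, hP (b - 1) (by omega), hP (b + 1) hbM, Nat.add_sub_cancel]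
    linarith [mul_le_mul_of_nonneg_left hprev hp0,
      mul_le_mul_of_nonneg_left (hv_conv b hb hbM) hq]
end
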